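/- Let I be the ideal of R generated by x2^{a12}x4^{a14}, x2^{a2} − x1^{a21}x3^{a23}, x3^{a3}, x4^{a4}, x3^{a23}x4^{a14}. Then the sequence 0 → R^2 →(φ3) R^6 →(φ2) R^5 →(φ1) R → R/I → 0 is exact, and it is a minimal free resolution of R/I. Here φ1 = (x2^{a12}x4^{a14}, x2^{a2}−x1^{a21}x3^{a23}, x3^{a3}, x4^{a4}, x3^{a23}x4^{a14}); φ2 is the 5×6 matrix with rows (0, 0, x3^{a23}, x4^{a34}, x2^{a42}, 0), (0, −x3^{a3}, 0, 0, −x4^{a14}, 0), (x4^{a14}, x2^{a2}−x1^{a21}x3^{a23}, 0, 0, 0, 0), (0, 0, 0, −x2^{a12}, 0, −x3^{a23}), (−x3^{a43}, 0, −x2^{a12}, 0, −x1^{a21}, x4^{a34}); and φ3 is the 6×2 matrix with rows (x2^{a2}−x1^{a21}x3^{a23}, 0), (−x4^{a14}, 0), (−x2^{a42}x3^{a43}, x4^{a34}), (0, −x3^{a23}), (x3^{a3}, 0), (0, x2^{a12}). -/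

import Mathlib

open MvPolynomial Matrix

/-- A power of a variable is a nonzerodivisor modulo a monomial ideal not involving it. -/
theorem MvPolynomial.mem_span_monomial_of_X_pow_mul_mem {σ k : Type*} [Field k]
    {S : Set (σ →₀ ℕ)} {l : σ} (hS : ∀ e ∈ S, e l = 0) {n : ℕ} {a : MvPolynomial σ k}
    (h : X l ^ n * a ∈ Ideal.span ((fun e => monomial e (1 : k)) '' S)) :
    a ∈ Ideal.span ((fun e => monomial e (1 : k)) '' S) := by
  classical
  rw [mem_ideal_span_monomial_image] at h ⊢
  intro e he
  obtain ⟨s, hs, hle⟩ := h (Finsupp.single l n + e) (by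
    rw [mem_support_iff, X_pow_eq_monomial, coeff_monomial_mul, one_mul]
    exact mem_support_iff.mp he)
  refine ⟨s, hs, fun i => ?_⟩
  by_cases hi : i = l
  · rw [hi, hS s hs]
    exact Nat.zero_le _
  · simpa [Finsupp.single_apply, Ne.symm hi] using hle i

theorem MvPolynomial.mem_span_X_pow_pair_of_X_pow_mul_mem {σ k : Type*} [Field k]
    {i j l : σ} (hi : i ≠ l) (hj : j ≠ l) {n p q : ℕ} {a : MvPolynomial σ k}
    (h : X l ^ n * a ∈ Ideal.span {X i ^ p, X j ^ q}) :
    a ∈ Ideal.span {X i ^ p, X j ^ q} := by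
  have key : ({X i ^ p, X j ^ q} : Set (MvPolynomial σ k)) =
      (fun e => monomial e (1 : k)) '' {Finsupp.single i p, Finsupp.single j q} := by
    simp [Set.image_pair, X_pow_eq_monomial]
  rw [key] at h ⊢
  refine mem_span_monomial_of_X_pow_mul_mem ?_ h
  rintro e (rfl | rfl) <;> simp [hi, hj]

theorem MvPolynomial.X_pow_dvd_of_dvd_X_pow_mul {σ k : Type*} [Field k]
    {i l : σ} (hi : i ≠ l) {n p : ℕ} {a : MvPolynomial σ k}
    (h : X i ^ p ∣ X l ^ n * a) : X i ^ p ∣ a := by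
  rw [← Ideal.mem_span_singleton, ← Set.pair_eq_singleton] at h ⊢
  exact mem_span_X_pow_pair_of_X_pow_mul_mem hi hi h

/-- Modulo `X i ^ p` and `X j ^ q`, the difference of a power of a third variable and a multiple
of `X j` is a nonzerodivisor. -/
theorem MvPolynomial.mem_span_X_pow_pair_of_sub_mul_mem {σ k : Type*} [Field k]
    {i j l : σ} (hi : i ≠ l) (hj : j ≠ l) {n p q : ℕ} {a b : MvPolynomial σ k}
    (hb : X j ∣ b) (h : (X l ^ n - b) * a ∈ Ideal.span {X i ^ p, X j ^ q}) :
    a ∈ Ideal.span {X i ^ p, X j ^ q} := by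
  obtain ⟨c, hc⟩ := sub_dvd_pow_sub_pow (X l ^ n) b q
  have hbq : b ^ q ∈ Ideal.span {X i ^ p, X j ^ q} :=
    Ideal.mem_of_dvd _ (pow_dvd_pow_of_dvd hb q) (Ideal.subset_span (by simp))
  refine mem_span_X_pow_pair_of_X_pow_mul_mem (n := n * q) hi hj ?_
  have e : X l ^ (n * q) * a = c * ((X l ^ n - b) * a) + a * b ^ q := by
    rw [pow_mul]
    linear_combination a * hc
  rw [e]
  exact add_mem (Ideal.mul_mem_left _ _ h) (Ideal.mul_mem_left _ _ hbq)

theorem gorenstein_tangent_cone_resolution_case_3a_stmt11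
    (k : Type*) [Field k]
    (a21 a31 a12 a42 a23 a43 a14 a34 a1 a2 a3 a4 : ℕ)
    (h21 : 0 < a21)
    (h31 : 0 < a31)
    (h12 : 0 < a12)
    (h42 : 0 < a42)
    (h23 : 0 < a23)
    (h43 : 0 < a43)
    (h14 : 0 < a14)
    (h34 : 0 < a34)
    (ha1 : a1 = a21 + a31)
    (ha2 : a2 = a12 + a42)
    (ha3 : a3 = a23 + a43)
    (ha4 : a4 = a14 + a34)
    (hc1 : a12 + a14 < a1)
    (hc2 : a4 < a42 + a43)
    (hc3 : a2 ≤ a21 + a23)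
    (hc4 : a3 ≤ a31 + a34)
    (x1 x2 x3 x4 : MvPolynomial (Fin 4) k)
    (hx1 : x1 = X 0) (hx2 : x2 = X 1) (hx3 : x3 = X 2) (hx4 : x4 = X 3)
    (I m : Ideal (MvPolynomial (Fin 4) k))
    (hI : I = Ideal.span {x2 ^ a12 * x4 ^ a14, x2 ^ a2 - x1 ^ a21 * x3 ^ a23, x3 ^ a3, x4 ^ a4, x3 ^ a23 * x4 ^ a14})
    (hm : m = Ideal.span {x1, x2, x3, x4})
    (g : Fin 5 → MvPolynomial (Fin 4) k)
    (hg : g = ![x2 ^ a12 * x4 ^ a14, x2 ^ a2 - x1 ^ a21 * x3 ^ a23, x3 ^ a3, x4 ^ a4, x3 ^ a23 * x4 ^ a14])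
    (φ1 : (Fin 5 → MvPolynomial (Fin 4) k) →ₗ[MvPolynomial (Fin 4) k]
      MvPolynomial (Fin 4) k)
    (hφ1 : ∀ v, φ1 v = ∑ i, v i * g i)
    (M2 : Matrix (Fin 5) (Fin 6) (MvPolynomial (Fin 4) k))
    (hM2 : M2 = !![0, 0, x3 ^ a23, x4 ^ a34, x2 ^ a42, 0;
      0, -x3 ^ a3, 0, 0, -x4 ^ a14, 0;
      x4 ^ a14, x2 ^ a2 - x1 ^ a21 * x3 ^ a23, 0, 0, 0, 0;
      0, 0, 0, -x2 ^ a12, 0, -x3 ^ a23;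
      -x3 ^ a43, 0, -x2 ^ a12, 0, -x1 ^ a21, x4 ^ a34])
    (M3 : Matrix (Fin 6) (Fin 2) (MvPolynomial (Fin 4) k))
    (hM3 : M3 = !![x2 ^ a2 - x1 ^ a21 * x3 ^ a23, 0;
      -x4 ^ a14, 0;
      -(x2 ^ a42 * x3 ^ a43), x4 ^ a34;
      0, -x3 ^ a23;
      x3 ^ a3, 0;
      0, x2 ^ a12]) :
    Function.Injective ⇑M3.mulVecLin ∧
    Function.Exact ⇑M3.mulVecLin ⇑M2.mulVecLin ∧
    Function.Exact ⇑M2.mulVecLin ⇑φ1 ∧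
    LinearMap.range φ1 = I ∧
    Function.Surjective (Ideal.Quotient.mk I) ∧
    (∀ i, g i ∈ m) ∧ (∀ i j, M2 i j ∈ m) ∧ (∀ i j, M3 i j ∈ m) := by
  
  have n2 : ∀ n, x2 ^ n ≠ 0 := fun n => hx2 ▸ pow_ne_zero n (X_ne_zero _)
  have n3 : ∀ n, x3 ^ n ≠ 0 := fun n => hx3 ▸ pow_ne_zero n (X_ne_zero _)
  have n4 : ∀ n, x4 ^ n ≠ 0 := fun n => hx4 ▸ pow_ne_zero n (X_ne_zero _)
  have d43 : ∀ p n a, x4 ^ p ∣ x3 ^ n * a → x4 ^ p ∣ a := fun p n a h => by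
    subst hx3 hx4; exact X_pow_dvd_of_dvd_X_pow_mul (by decide) h
  have d23 : ∀ p n a, x2 ^ p ∣ x3 ^ n * a → x2 ^ p ∣ a := fun p n a h => by
    subst hx2 hx3; exact X_pow_dvd_of_dvd_X_pow_mul (by decide) h
  have d34 : ∀ p n a, x3 ^ p ∣ x4 ^ n * a → x3 ^ p ∣ a := fun p n a h => by
    subst hx3 hx4; exact X_pow_dvd_of_dvd_X_pow_mul (by decide) h
  have r2 : ∀ a, x2 ^ a12 * a ∈ Ideal.span {x4 ^ a34, x3 ^ a23} →
      a ∈ Ideal.span {x4 ^ a34, x3 ^ a23} := fun a h => by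
    subst hx2 hx3 hx4; exact mem_span_X_pow_pair_of_X_pow_mul_mem (by decide) (by decide) h
  have rF : ∀ a, (x2 ^ a2 - x1 ^ a21 * x3 ^ a23) * a ∈ Ideal.span {x4 ^ a14, x3 ^ a3} →
      a ∈ Ideal.span {x4 ^ a14, x3 ^ a3} := fun a h => by
    have hd : x3 ∣ x1 ^ a21 * x3 ^ a23 := (dvd_pow_self x3 h23.ne').mul_left _
    subst hx2 hx3 hx4
    exact mem_span_X_pow_pair_of_sub_mul_mem (by decide) (by decide) hd h
  have m1 : x1 ∈ m := hm ▸ Ideal.subset_span (by simp)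
  have m2 : x2 ∈ m := hm ▸ Ideal.subset_span (by simp)
  have m3 : x3 ∈ m := hm ▸ Ideal.subset_span (by simp)
  have m4 : x4 ∈ m := hm ▸ Ideal.subset_span (by simp)
  have p1 : ∀ n, 0 < n → x1 ^ n ∈ m := fun n hn => Ideal.pow_mem_of_mem _ m1 n hn
  have p2 : ∀ n, 0 < n → x2 ^ n ∈ m := fun n hn => Ideal.pow_mem_of_mem _ m2 n hn
  have p3 : ∀ n, 0 < n → x3 ^ n ∈ m := fun n hn => Ideal.pow_mem_of_mem _ m3 n hn
  have p4 : ∀ n, 0 < n → x4 ^ n ∈ m := fun n hn => Ideal.pow_mem_of_mem _ m4 n hn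
  have pF : x2 ^ a2 - x1 ^ a21 * x3 ^ a23 ∈ m :=
    sub_mem (p2 _ (by omega)) (Ideal.mul_mem_left _ _ (p3 _ h23))
  have e2 : x2 ^ a2 = x2 ^ a12 * x2 ^ a42 := by rw [ha2, pow_add]
  have e3 : x3 ^ a3 = x3 ^ a23 * x3 ^ a43 := by rw [ha3, pow_add]
  have e4 : x4 ^ a4 = x4 ^ a14 * x4 ^ a34 := by rw [ha4, pow_add]
  refine ⟨?_, ?_, ?_, ?_, Ideal.Quotient.mk_surjective, ?_, ?_, ?_⟩
  · rw [injective_iff_map_eq_zero]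
    intro v hv
    have h1 := congrFun hv 1
    have h3 := congrFun hv 3
    simp [hM3, mulVec, dotProduct, Fin.sum_univ_succ, (n3 _), (n4 _), -pow_eq_zero_iff] at h1 h3
    ext1 i
    fin_cases i <;> simp [h1, h3]
  · intro v
    constructor
    · intro hv
      have h0 := congrFun hv 0
      have h1 := congrFun hv 1
      have h2 := congrFun hv 2
      have h3 := congrFun hv 3
      simp [hM2, mulVec, dotProduct, Fin.sum_univ_six, -pow_eq_zero_iff] at h0 h1 h2 h3
      obtain ⟨s, hs⟩ := d43 a14 a3 (v 1) ⟨-v 4, by linear_combination -h1⟩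
      obtain ⟨t, ht⟩ := d23 a12 a23 (v 5) ⟨-v 3, by linear_combination -h3⟩
      have hv4 : v 4 = -(x3 ^ a3 * s) := mul_left_cancel₀ (n4 a14) (by
        linear_combination -h1 - x3 ^ a3 * hs)
      have hv3 : v 3 = -(x3 ^ a23 * t) := mul_left_cancel₀ (n2 a12) (by
        linear_combination -h3 - x3 ^ a23 * ht)
      have hv0 : v 0 = -((x2 ^ a2 - x1 ^ a21 * x3 ^ a23) * s) := mul_left_cancel₀ (n4 a14) (by
        linear_combination h2 - (x2 ^ a2 - x1 ^ a21 * x3 ^ a23) * hs)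
      have hv2 : v 2 = x2 ^ a42 * x3 ^ a43 * s + x4 ^ a34 * t := mul_left_cancel₀ (n3 a23) (by
        linear_combination h0 - x4 ^ a34 * hv3 - x2 ^ a42 * hv4 + x2 ^ a42 * s * e3)
      refine ⟨![-s, t], ?_⟩
      ext1 i
      fin_cases i <;> simp [hM3, mulVec, dotProduct, hv0, hs, hv2, hv3, hv4, ht]
    · rintro ⟨u, rfl⟩
      ext1 i
      fin_cases i <;> simp [hM2, hM3, mulVec, dotProduct, Fin.sum_univ_six, e2, e3] <;> ring
  · intro v
    constructor
    · intro hv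
      rw [hφ1] at hv
      simp [hg, Fin.sum_univ_five] at hv
      obtain ⟨a, b, hab⟩ := Ideal.mem_span_pair.mp (rF (v 1) (Ideal.mem_span_pair.mpr
        ⟨-(v 0 * x2 ^ a12 + v 3 * x4 ^ a34 + v 4 * x3 ^ a23), -v 2, by
          linear_combination -hv + v 3 * e4⟩))
      obtain ⟨c, hc⟩ := d43 a14 a3 (v 2 + b * (x2 ^ a2 - x1 ^ a21 * x3 ^ a23))
        ⟨-(v 0 * x2 ^ a12 + a * (x2 ^ a2 - x1 ^ a21 * x3 ^ a23) + v 3 * x4 ^ a34 +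
          v 4 * x3 ^ a23), by
          linear_combination hv + (x2 ^ a2 - x1 ^ a21 * x3 ^ a23) * hab - v 3 * e4⟩
      have hv' : v 0 * x2 ^ a12 + a * (x2 ^ a2 - x1 ^ a21 * x3 ^ a23) + v 3 * x4 ^ a34 +
          v 4 * x3 ^ a23 + x3 ^ a3 * c = 0 := mul_left_cancel₀ (n4 a14) (by
        linear_combination hv + (x2 ^ a2 - x1 ^ a21 * x3 ^ a23) * hab - v 3 * e4 - x3 ^ a3 * hc)
      obtain ⟨d, e, hde⟩ := Ideal.mem_span_pair.mp (r2 (v 0 + a * x2 ^ a42)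
        (Ideal.mem_span_pair.mpr ⟨-v 3, -(v 4 - a * x1 ^ a21 + x3 ^ a43 * c), by
          linear_combination -hv' + a * e2 + c * e3⟩))
      obtain ⟨f, hf⟩ := d43 a34 a23 (v 4 - a * x1 ^ a21 + x3 ^ a43 * c + x2 ^ a12 * e)
        ⟨-(v 3 + x2 ^ a12 * d), by
          linear_combination hv' + x2 ^ a12 * hde - a * e2 - c * e3⟩
      have hv3 : v 3 + x2 ^ a12 * d = -(x3 ^ a23 * f) := mul_left_cancel₀ (n4 a34) (by
        linear_combination hv' + x2 ^ a12 * hde - a * e2 - c * e3 - x3 ^ a23 * hf)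
      refine ⟨![c, -b, e, d, -a, f], ?_⟩
      ext1 i
      fin_cases i <;> simp [hM2, mulVec, dotProduct, Fin.sum_univ_six]
      · linear_combination hde
      · linear_combination hab
      · linear_combination -hc
      · linear_combination -hv3
      · linear_combination -hf
    · rintro ⟨u, rfl⟩
      rw [hφ1]
      simp [hg, hM2, mulVec, dotProduct, Fin.sum_univ_five, Fin.sum_univ_six, e2, e3, e4]
      ring
  · have : φ1 = Fintype.linearCombination (MvPolynomial (Fin 4) k) g := by
      refine LinearMap.ext fun v => ?_
      simp [hφ1, Fintype.linearCombination_apply]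
    rw [this, Fintype.range_linearCombination, hI, hg, Ideal.span]
    congr 1
    ext p
    simp only [Set.mem_range, Set.mem_insert_iff, Set.mem_singleton_iff, Fin.exists_fin_succ]
    simp [eq_comm (a := p)]
  · have q3 := p3 a3 (by omega)
    have q4 := p4 a4 (by omega)
    intro i
    rw [hg]
    fin_cases i
    exacts [Ideal.mul_mem_left _ _ (p4 _ h14), pF, q3, q4, Ideal.mul_mem_left _ _ (p4 _ h14)]
  · have q3 := p3 a3 (by omega)
    clear * - pF q3 p1 p2 p3 p4 h21 h12 h42 h23 h43 h14 h34 hM2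
    intro i j
    rw [hM2]
    fin_cases i <;> fin_cases j <;> simp [*]
  · have q3 := p3 a3 (by omega)
    have q : x2 ^ a42 * x3 ^ a43 ∈ m := Ideal.mul_mem_left _ _ (p3 _ h43)
    clear * - pF q3 q p1 p2 p3 p4 h21 h12 h42 h23 h43 h14 h34 hM3
    intro i j
    rw [hM3]
    fin_cases i <;> fin_cases j <;> simp [*]
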